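/- arXiv:1904.10385 — 2 statements merged into one kernel-verified Lean document; each statement's English description precedes it below -/
import Mathlib

section
/- For every strongly continuous V : [0,∞) → L(X₀), the equation W = V + B(W) has a unique strongly continuous solution W : [0,∞) → L(X₀); moreover W(t) = Σ_{n=0}^∞ Bⁿ(V)(t), where the series converges in the operator norm, uniformly on every bounded interval [0,τ]. -/
open Set Filter MeasureTheory
open scoped Topology

noncomputable section

structure MRSetting (X : Type*) [NormedAddCommGroup X] [NormedSpace ℂ X] [CompleteSpace X]
    (X₀ : Submodule ℂ X) where
  closed : IsClosed (X₀ : Set X)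
  T : ℝ → (X₀ →L[ℂ] X₀)
  S : ℝ → (X →L[ℂ] X₀)
  T_zero : T 0 = 1
  T_add : ∀ t s : ℝ, 0 ≤ t → 0 ≤ s → T (t + s) = (T t).comp (T s)
  T_cont : ∀ x : X₀, ContinuousOn (fun t => T t x) (Ici 0)
  S_zero : S 0 = 0
  S_cont : ∀ x : X, ContinuousOn (fun t => S t x) (Ici 0)
  TS : ∀ t s : ℝ, 0 ≤ t → 0 ≤ s → ∀ x : X, T t (S s x) = S (t + s) x - S t x
  δ : ℝ → ℝ
  δ_nonneg : ∀ t : ℝ, 0 ≤ t → 0 ≤ δ t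
  δ_mono : MonotoneOn δ (Ici 0)
  δ_lim : Tendsto δ (𝓝[>] 0) (𝓝 0)
  SD : (ℝ → X) → ℝ → X₀
  SD_deriv : ∀ f : ℝ → X, ContinuousOn f (Ici 0) → ∀ t ∈ Ici (0:ℝ),
    HasDerivWithinAt (fun τ : ℝ => ∫ s in (0:ℝ)..τ, S (τ - s) (f s)) (SD f t) (Ici 0) t
  SD_cont : ∀ f : ℝ → X, ContinuousOn f (Ici 0) → ContinuousOn (SD f) (Ici 0)
  SD_bound : ∀ f : ℝ → X, ContinuousOn f (Ici 0) → ∀ t ∈ Ici (0:ℝ),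
    ‖SD f t‖ ≤ δ t * ⨆ s : Icc (0:ℝ) t, ‖f (s : ℝ)‖
  SDop : (ℝ → (X₀ →L[ℂ] X)) → ℝ → (X₀ →L[ℂ] X₀)
  SDop_apply : ∀ V : ℝ → (X₀ →L[ℂ] X), (∀ x : X₀, ContinuousOn (fun s => V s x) (Ici 0)) →
    ∀ t : ℝ, ∀ x : X₀, SDop V t x = SD (fun s => V s x) t

variable {X : Type*} [NormedAddCommGroup X] [NormedSpace ℂ X] [CompleteSpace X]
  {X₀ : Submodule ℂ X}

/-- The perturbation operator `B(U) = S ⋄ (L ∘ U)`. -/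
def MRSetting.Bop (M : MRSetting X X₀) (L : X₀ →L[ℂ] X) (U : ℝ → (X₀ →L[ℂ] X₀)) :
    ℝ → (X₀ →L[ℂ] X₀) :=
  M.SDop (fun s => L.comp (U s))


/-- Uniform boundedness on compact intervals. -/
theorem mr_bdd {E F : Type*} [NormedAddCommGroup E] [NormedSpace ℂ E] [CompleteSpace E]
    [NormedAddCommGroup F] [NormedSpace ℂ F] (U : ℝ → (E →L[ℂ] F))
    (hU : ∀ x, ContinuousOn (fun t => U t x) (Ici 0)) (a : ℝ) :
    ∃ C, 0 ≤ C ∧ ∀ t ∈ Icc (0:ℝ) a, ‖U t‖ ≤ C := by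
  obtain ⟨C, hC⟩ := banach_steinhaus (g := fun t : Icc (0:ℝ) a => U t) (by
    intro x
    obtain ⟨C, hC⟩ := (isCompact_Icc (a := (0:ℝ)) (b := a)).exists_bound_of_continuousOn
      ((hU x).mono Icc_subset_Ici_self)
    exact ⟨C, fun t => hC t t.2⟩)
  exact ⟨max C 0, le_max_right _ _, fun t ht => (hC ⟨t, ht⟩).trans (le_max_left _ _)⟩

/-- Continuity of `s ↦ U (u s) (f s)`. -/
theorem mr_cont {E F : Type*} [NormedAddCommGroup E] [NormedSpace ℂ E] [CompleteSpace E]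
    [NormedAddCommGroup F] [NormedSpace ℂ F] (U : ℝ → (E →L[ℂ] F))
    (hU : ∀ x, ContinuousOn (fun t => U t x) (Ici 0)) (a : ℝ) (K : Set ℝ) (u : ℝ → ℝ)
    (f : ℝ → E) (hu : ContinuousOn u K) (hf : ContinuousOn f K)
    (huK : ∀ s ∈ K, u s ∈ Icc (0:ℝ) a) :
    ContinuousOn (fun s => U (u s) (f s)) K := by
  obtain ⟨C, hC0, hC⟩ := mr_bdd U hU a
  intro s₀ hs₀
  have h1 : Tendsto (fun s => U (u s) (f s₀)) (𝓝[K] s₀) (𝓝 (U (u s₀) (f s₀))) :=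
    ((hU (f s₀)).comp hu (fun s hs => (huK s hs).1)) s₀ hs₀
  have h2 : Tendsto (fun s => U (u s) (f s - f s₀)) (𝓝[K] s₀) (𝓝 0) := by
    have h3 : Tendsto (fun s => C * ‖f s - f s₀‖) (𝓝[K] s₀) (𝓝 0) := by
      have := ((hf s₀ hs₀).tendsto.sub_const (f s₀)).norm.const_mul C
      simpa using this
    refine squeeze_zero_norm' ?_ h3
    filter_upwards [self_mem_nhdsWithin] with s hs
    exact (U (u s)).le_of_opNorm_le (hC _ (huK s hs)) _
  have h4 := h1.add h2
  simpa [ContinuousWithinAt] using h4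

theorem mr_intble (M : MRSetting X X₀) (f : ℝ → X) (hf : ContinuousOn f (Ici 0))
    (a b c : ℝ) (hb : 0 ≤ b) (hbc : b ≤ c) (hca : c ≤ a) :
    IntervalIntegrable (fun s => M.S (a - s) (f s)) volume b c := by
  apply ContinuousOn.intervalIntegrable
  rw [uIcc_of_le hbc]
  refine mr_cont M.S M.S_cont a _ (fun s => a - s) f (by fun_prop)
    (hf.mono fun s hs => hb.trans hs.1) ?_
  intro s hs
  have := hs.1
  have := hs.2
  constructor <;> linarith

theorem mr_delta_zero (M : MRSetting X X₀) : M.δ 0 = 0 := by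
  refine le_antisymm ?_ (M.δ_nonneg 0 le_rfl)
  refine ge_of_tendsto M.δ_lim ?_
  filter_upwards [self_mem_nhdsWithin] with t ht
  exact M.δ_mono (mem_Ici.2 le_rfl) (mem_Ici.2 (le_of_lt ht)) (le_of_lt ht)

theorem mr_SD_zero (M : MRSetting X X₀) (f : ℝ → X) (hf : ContinuousOn f (Ici 0)) :
    M.SD f 0 = 0 := by
  have := M.SD_bound f hf 0 (mem_Ici.2 le_rfl)
  rw [mr_delta_zero, zero_mul] at this
  exact norm_le_zero_iff.1 this

theorem mr_shift_cont (f : ℝ → X) (hf : ContinuousOn f (Ici 0)) (h : ℝ) (hh : 0 ≤ h) :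
    ContinuousOn (fun s => f (s + h)) (Ici 0) :=
  hf.comp (by fun_prop) (fun s hs => add_nonneg hs hh)

theorem mr_shift_int (M : MRSetting X X₀) (f : ℝ → X) (a t h : ℝ) :
    ∫ s in (0:ℝ)..t, M.S (a - s) (f (s + h)) = ∫ s in h..(t + h), M.S (a + h - s) (f s) := by
  have := intervalIntegral.integral_comp_add_right (a := 0) (b := t)
    (fun s => M.S (a + h - s) (f s)) h
  simp only [zero_add, add_sub_add_right_eq_sub] at this
  exact this

theorem mr_SD_sub (M : MRSetting X X₀) (f g : ℝ → X) (hf : ContinuousOn f (Ici 0))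
    (hg : ContinuousOn g (Ici 0)) (t : ℝ) (ht : 0 ≤ t) :
    M.SD (fun s => f s - g s) t = M.SD f t - M.SD g t := by
  have h1 := M.SD_deriv _ (hf.sub hg) t ht
  have h2 := (M.SD_deriv f hf t ht).sub (M.SD_deriv g hg t ht)
  refine (uniqueDiffOn_Ici (0:ℝ) t ht).eq_deriv _ h1 (h2.congr ?_ ?_)
  · intro τ hτ
    have hτ' : (0:ℝ) ≤ τ := hτ
    simp only [Pi.sub_apply, map_sub]
    exact intervalIntegral.integral_sub (mr_intble M f hf τ 0 τ le_rfl hτ' le_rfl)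
      (mr_intble M g hg τ 0 τ le_rfl hτ' le_rfl)
  · simp only [Pi.sub_apply, map_sub]
    exact intervalIntegral.integral_sub (mr_intble M f hf t 0 t le_rfl ht le_rfl)
      (mr_intble M g hg t 0 t le_rfl ht le_rfl)

/-- `S ⋄ f` as a derivative at zero. -/
theorem mr_H (M : MRSetting X X₀) (f : ℝ → X) (hf : ContinuousOn f (Ici 0))
    (t : ℝ) (ht : 0 ≤ t) :
    HasDerivWithinAt (fun η : ℝ => ∫ s in (0:ℝ)..t, M.S (η + t - s) (f s)) (M.SD f t)
      (Ici 0) 0 := by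
  have hs := mr_shift_cont f hf t ht
  have h2 := M.SD_deriv _ hs 0 (mem_Ici.2 le_rfl)
  rw [mr_SD_zero M _ hs] at h2
  have h1 : HasDerivWithinAt (fun η : ℝ => ∫ s in (0:ℝ)..(η + t), M.S (η + t - s) (f s))
      (M.SD f t) (Ici 0) 0 := by
    have h0 := M.SD_deriv f hf t ht
    have h0' : HasDerivWithinAt (fun τ : ℝ => ∫ s in (0:ℝ)..τ, M.S (τ - s) (f s)) (M.SD f t)
      (Ici 0) (0 + t) := by simpa using h0
    have := h0'.scomp (h := fun η : ℝ => η + t) (h' := 1) (s := Ici 0) (0:ℝ)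
      ((hasDerivWithinAt_id _ _).add_const t) (fun s hs => add_nonneg hs ht)
    simpa [Function.comp_def] using this
  have h3 := h1.sub h2
  rw [sub_zero] at h3
  have key : ∀ η ∈ Ici (0:ℝ), ∫ s in (0:ℝ)..t, M.S (η + t - s) (f s) =
      (∫ s in (0:ℝ)..(η + t), M.S (η + t - s) (f s)) -
        ∫ s in (0:ℝ)..η, M.S (η - s) (f (s + t)) := by
    intro η hη
    have hη' : (0:ℝ) ≤ η := hη
    rw [mr_shift_int, eq_sub_iff_add_eq]
    exact intervalIntegral.integral_add_adjacent_intervals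
      (mr_intble M f hf _ _ _ le_rfl ht (by linarith))
      (mr_intble M f hf _ _ _ ht (by linarith) le_rfl)
  exact h3.congr key (key 0 (mem_Ici.2 le_rfl))

theorem mr_SD_add (M : MRSetting X X₀) (hc : CompleteSpace X₀) (f : ℝ → X)
    (hf : ContinuousOn f (Ici 0)) (t h : ℝ) (ht : 0 ≤ t) (hh : 0 ≤ h) :
    M.SD f (t + h) = M.T t (M.SD f h) + M.SD (fun s => f (s + h)) t := by
  have hs := mr_shift_cont f hf h hh
  have h1 := mr_H M f hf (t + h) (add_nonneg ht hh)
  have h2 := mr_H M _ hs t ht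
  have h3 := mr_H M f hf h hh
  have h4 : HasDerivWithinAt
      (fun η : ℝ => M.T t (∫ s in (0:ℝ)..h, M.S (η + h - s) (f s))) (M.T t (M.SD f h))
      (Ici 0) 0 :=
    ((M.T t).restrictScalars ℝ).hasFDerivAt.comp_hasDerivWithinAt (0:ℝ) h3
  have h5 := (h4.add_const (∫ s in (0:ℝ)..h, M.S t (f s))).add h2
  have key : ∀ η ∈ Ici (0:ℝ), ∫ s in (0:ℝ)..(t + h), M.S (η + (t + h) - s) (f s) =
      (M.T t (∫ s in (0:ℝ)..h, M.S (η + h - s) (f s)) + ∫ s in (0:ℝ)..h, M.S t (f s)) +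
        ∫ s in (0:ℝ)..t, M.S (η + t - s) (f (s + h)) := by
    intro η hη
    have hη' : (0:ℝ) ≤ η := hη
    have hi := mr_intble M f hf (η + h) 0 h le_rfl hh (by linarith)
    have hi2 : IntervalIntegrable (fun s => M.S t (f s)) volume 0 h := by
      apply ContinuousOn.intervalIntegrable
      rw [uIcc_of_le hh]
      exact (M.S t).continuous.comp_continuousOn (hf.mono fun s hs => hs.1)
    have hi3 : IntervalIntegrable (fun s => M.T t (M.S (η + h - s) (f s))) volume 0 h := by
      apply ContinuousOn.intervalIntegrable
      rw [uIcc_of_le hh]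
      refine (M.T t).continuous.comp_continuousOn
        (mr_cont M.S M.S_cont (η + h) _ (fun s => η + h - s) f (by fun_prop)
          (hf.mono fun s hs => hs.1) ?_)
      intro s hs
      have := hs.1
      have := hs.2
      constructor <;> linarith
    rw [mr_shift_int, ← (M.T t).intervalIntegral_comp_comm hi,
      ← intervalIntegral.integral_add hi3 hi2,
      ← intervalIntegral.integral_add_adjacent_intervals
        (mr_intble M f hf (η + (t + h)) 0 h le_rfl hh (by linarith))
        (mr_intble M f hf (η + (t + h)) h (t + h) hh (by linarith) (by linarith))]
    congr 1
    · apply intervalIntegral.integral_congr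
      intro s hs
      rw [uIcc_of_le hh] at hs
      have := hs.2
      simp only
      rw [M.TS t (η + h - s) ht (by linarith), sub_add_cancel]
      congr 2
      ring
    · rw [add_assoc]
  exact (uniqueDiffOn_Ici (0:ℝ) 0 (mem_Ici.2 le_rfl)).eq_deriv _ h1
    (h5.congr key (key 0 (mem_Ici.2 le_rfl)))

theorem mr_SD_bound' (M : MRSetting X X₀) (f : ℝ → X) (hf : ContinuousOn f (Ici 0))
    (t D : ℝ) (ht : 0 ≤ t) (hD : ∀ s ∈ Icc (0:ℝ) t, ‖f s‖ ≤ D) :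
    ‖M.SD f t‖ ≤ M.δ t * D := by
  refine (M.SD_bound f hf t ht).trans (mul_le_mul_of_nonneg_left ?_ (M.δ_nonneg t ht))
  have : Nonempty (Icc (0:ℝ) t) := ⟨⟨0, le_rfl, ht⟩⟩
  exact ciSup_le fun s => hD s s.2

/-- Weighted estimate. -/
theorem mr_weighted (M : MRSetting X X₀) (hc : CompleteSpace X₀) (ε l : ℝ) (hε : 0 < ε)
    (hl : 0 ≤ l) (hT : ‖M.T ε‖ * Real.exp (-(l * ε)) ≤ 1 / 2) (n : ℕ) :
    ∀ (f : ℝ → X), ContinuousOn f (Ici 0) → ∀ (t C : ℝ), 0 ≤ t → t ≤ n * ε →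
      (∀ s ∈ Icc (0:ℝ) t, ‖f s‖ ≤ C * Real.exp (l * s)) →
      ‖M.SD f t‖ ≤ 2 * M.δ ε * (C * Real.exp (l * t)) := by
  have hδ := M.δ_nonneg ε hε.le
  have small : ∀ (f : ℝ → X), ContinuousOn f (Ici 0) → ∀ (t D : ℝ), 0 ≤ t → t ≤ ε →
      (∀ s ∈ Icc (0:ℝ) t, ‖f s‖ ≤ D) → ‖M.SD f t‖ ≤ M.δ ε * D := by
    intro f hf t D ht hte hD
    have hD0 : 0 ≤ D := (norm_nonneg _).trans (hD 0 ⟨le_rfl, ht⟩)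
    exact (mr_SD_bound' M f hf t D ht hD).trans
      (mul_le_mul_of_nonneg_right (M.δ_mono (mem_Ici.2 ht) (mem_Ici.2 hε.le) hte) hD0)
  have mono : ∀ (f : ℝ → X) (t C : ℝ), 0 ≤ t →
      (∀ s ∈ Icc (0:ℝ) t, ‖f s‖ ≤ C * Real.exp (l * s)) →
      0 ≤ C ∧ ∀ s ∈ Icc (0:ℝ) t, ‖f s‖ ≤ C * Real.exp (l * t) := by
    intro f t C ht hC
    have hC0 : 0 ≤ C := by
      have := (norm_nonneg _).trans (hC 0 ⟨le_rfl, ht⟩)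
      simpa using this
    refine ⟨hC0, fun s hs => (hC s hs).trans ?_⟩
    have := hs.2
    gcongr
  induction n with
  | zero =>
    intro f hf t C ht htn hC
    obtain ⟨hC0, hm⟩ := mono f t C ht hC
    have h := small f hf t _ ht (htn.trans (by simpa using hε.le)) hm
    have : 0 ≤ M.δ ε * (C * Real.exp (l * t)) := by positivity
    linarith
  | succ n ih =>
    intro f hf t C ht htn hC
    obtain ⟨hC0, hm⟩ := mono f t C ht hC
    have hnn : 0 ≤ M.δ ε * (C * Real.exp (l * t)) := by positivity
    rcases le_total t ε with hte | hte
    · have h := small f hf t _ ht hte hm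
      linarith
    · have h0 : 0 ≤ t - ε := by linarith
      have hadd := mr_SD_add M hc f hf ε (t - ε) hε.le h0
      rw [add_sub_cancel] at hadd
      have h1 := small _ (mr_shift_cont f hf (t - ε) h0) ε (C * Real.exp (l * t)) hε.le le_rfl
        (fun s hs => hm _ ⟨by have := hs.1; linarith, by have := hs.2; linarith⟩)
      have h2 := ih f hf (t - ε) C h0 (by push_cast at htn; linarith)
        (fun s hs => hC s ⟨hs.1, by have := hs.2; linarith⟩)
      have h3 : ‖M.T ε (M.SD f (t - ε))‖ ≤ M.δ ε * (C * Real.exp (l * t)) := by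
        calc ‖M.T ε (M.SD f (t - ε))‖ ≤ ‖M.T ε‖ * (2 * M.δ ε * (C * Real.exp (l * (t - ε)))) :=
              ((M.T ε).le_opNorm _).trans (by gcongr)
          _ = (‖M.T ε‖ * Real.exp (-(l * ε))) * (2 * (M.δ ε * (C * Real.exp (l * t)))) := by
              rw [mul_sub, sub_eq_add_neg, Real.exp_add]; ring
          _ ≤ (1 / 2) * (2 * (M.δ ε * (C * Real.exp (l * t)))) := by gcongr
          _ = _ := by ring
      rw [hadd]
      refine (norm_add_le _ _).trans ?_
      linarith

theorem mr_comp_cont (L : X₀ →L[ℂ] X) (U : ℝ → (X₀ →L[ℂ] X₀))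
    (hU : ∀ x : X₀, ContinuousOn (fun t => U t x) (Ici 0)) (x : X₀) :
    ContinuousOn (fun s => (L.comp (U s)) x) (Ici 0) :=
  L.continuous.comp_continuousOn (hU x)

theorem mr_Bop_cont (M : MRSetting X X₀) (L : X₀ →L[ℂ] X) (U : ℝ → (X₀ →L[ℂ] X₀))
    (hU : ∀ x : X₀, ContinuousOn (fun t => U t x) (Ici 0)) (x : X₀) :
    ContinuousOn (fun t => M.Bop L U t x) (Ici 0) := by
  have := M.SD_cont _ (mr_comp_cont L U hU x)
  refine this.congr fun t _ => ?_
  exact M.SDop_apply _ (mr_comp_cont L U hU) t x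

theorem mr_Bop_sub (M : MRSetting X X₀) (L : X₀ →L[ℂ] X) (U U' : ℝ → (X₀ →L[ℂ] X₀))
    (hU : ∀ x : X₀, ContinuousOn (fun t => U t x) (Ici 0))
    (hU' : ∀ x : X₀, ContinuousOn (fun t => U' t x) (Ici 0)) (t : ℝ) (ht : 0 ≤ t) :
    M.Bop L (fun s => U s - U' s) t = M.Bop L U t - M.Bop L U' t := by
  ext1 x
  have hs : ∀ x : X₀, ContinuousOn (fun t => (U t - U' t) x) (Ici 0) :=
    fun x => (hU x).sub (hU' x)
  rw [ContinuousLinearMap.sub_apply]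
  unfold MRSetting.Bop
  rw [M.SDop_apply _ (mr_comp_cont L _ hs), M.SDop_apply _ (mr_comp_cont L _ hU),
    M.SDop_apply _ (mr_comp_cont L _ hU'),
    ← mr_SD_sub M _ _ (mr_comp_cont L _ hU x) (mr_comp_cont L _ hU' x) t ht]
  simp

theorem mr_Bop_bound (M : MRSetting X X₀) (hc : CompleteSpace X₀) (L : X₀ →L[ℂ] X) :
    ∃ l : ℝ, 0 ≤ l ∧ ∀ (U : ℝ → (X₀ →L[ℂ] X₀)),
      (∀ x : X₀, ContinuousOn (fun t => U t x) (Ici 0)) → ∀ (τ C : ℝ), 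
      (∀ s ∈ Icc (0:ℝ) τ, ‖U s‖ ≤ C * Real.exp (l * s)) →
      ∀ t ∈ Icc (0:ℝ) τ, ‖M.Bop L U t‖ ≤ C / 2 * Real.exp (l * t) := by
  obtain ⟨ε, hε, hεL⟩ : ∃ ε : ℝ, 0 < ε ∧ 2 * M.δ ε * ‖L‖ ≤ 1 / 2 := by
    have h : Tendsto (fun t => 2 * M.δ t * ‖L‖) (𝓝[>] 0) (𝓝 0) := by
      simpa using (M.δ_lim.const_mul 2).mul_const ‖L‖
    have h2 := (h.eventually (ge_mem_nhds (show (0:ℝ) < 1 / 2 by norm_num))).and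
      self_mem_nhdsWithin
    obtain ⟨ε, h3, h4⟩ := h2.exists
    exact ⟨ε, h4, h3⟩
  have hδ := M.δ_nonneg ε hε.le
  obtain ⟨l, hl, hT⟩ : ∃ l : ℝ, 0 ≤ l ∧ ‖M.T ε‖ * Real.exp (-(l * ε)) ≤ 1 / 2 := by
    have h : Tendsto (fun l : ℝ => ‖M.T ε‖ * Real.exp (-(l * ε))) atTop (𝓝 0) := by
      have := (Real.tendsto_exp_neg_atTop_nhds_zero.comp
        (tendsto_id.atTop_mul_const hε)).const_mul ‖M.T ε‖
      simpa [Function.comp_def] using this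
    have h2 := (h.eventually (ge_mem_nhds (show (0:ℝ) < 1 / 2 by norm_num))).and
      (eventually_ge_atTop (0:ℝ))
    obtain ⟨l, h3, h4⟩ := h2.exists
    exact ⟨l, h4, h3⟩
  refine ⟨l, hl, fun U hU τ C hC t ht => ?_⟩
  have hC0 : 0 ≤ C := by
    have := (norm_nonneg (U 0)).trans (hC 0 ⟨le_rfl, ht.1.trans ht.2⟩)
    simpa using this
  refine ContinuousLinearMap.opNorm_le_bound _ (by positivity) fun x => ?_
  unfold MRSetting.Bop
  rw [M.SDop_apply _ (mr_comp_cont L _ hU)]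
  obtain ⟨n, hn⟩ := exists_nat_ge (t / ε)
  have h := mr_weighted M hc ε l hε hl hT n _ (mr_comp_cont L _ hU x) t (‖L‖ * C * ‖x‖) ht.1
    ((div_le_iff₀ hε).1 hn) (fun s hs => by
      calc ‖L (U s x)‖ ≤ ‖L‖ * (C * Real.exp (l * s) * ‖x‖) :=
            (L.le_opNorm _).trans (by
              gcongr
              exact (U s).le_of_opNorm_le (hC s ⟨hs.1, hs.2.trans ht.2⟩) x)
        _ = _ := by ring)
  refine h.trans ?_
  calc 2 * M.δ ε * (‖L‖ * C * ‖x‖ * Real.exp (l * t))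
      = (2 * M.δ ε * ‖L‖) * (C * ‖x‖ * Real.exp (l * t)) := by ring
    _ ≤ (1 / 2) * (C * ‖x‖ * Real.exp (l * t)) := by gcongr
    _ = _ := by ring

/-- existence, uniqueness, and series representation of the solution of
`W = V + B(W)`. -/
theorem fixed_point_equation (M : MRSetting X X₀) (L : X₀ →L[ℂ] X)
    (V : ℝ → (X₀ →L[ℂ] X₀)) (hV : ∀ x : X₀, ContinuousOn (fun t => V t x) (Ici 0)) :
    ∃ W : ℝ → (X₀ →L[ℂ] X₀),
      (∀ x : X₀, ContinuousOn (fun t => W t x) (Ici 0)) ∧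
      (∀ t ∈ Ici (0:ℝ), W t = V t + M.Bop L W t) ∧
      (∀ τ : ℝ, 0 ≤ τ →
        TendstoUniformlyOn (fun N : ℕ => fun t : ℝ => ∑ n ∈ Finset.range N, (M.Bop L)^[n] V t)
          W atTop (Icc 0 τ)) ∧
      (∀ W' : ℝ → (X₀ →L[ℂ] X₀), (∀ x : X₀, ContinuousOn (fun t => W' t x) (Ici 0)) →
        (∀ t ∈ Ici (0:ℝ), W' t = V t + M.Bop L W' t) → ∀ t ∈ Ici (0:ℝ), W' t = W t) := by
  have hc : CompleteSpace X₀ := M.closed.completeSpace_coe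
  obtain ⟨l, hl, hB⟩ := mr_Bop_bound M hc L
  have hit : ∀ n : ℕ, ∀ x : X₀, ContinuousOn (fun t => (M.Bop L)^[n] V t x) (Ici 0) := by
    intro n
    induction n with
    | zero => exact hV
    | succ n ih =>
      rw [Function.iterate_succ_apply']
      exact mr_Bop_cont M L _ ih
  have hexp : ∀ s : ℝ, 0 ≤ s → 1 ≤ Real.exp (l * s) := fun s hs =>
    Real.one_le_exp (mul_nonneg hl hs)
  have hbd : ∀ τ : ℝ, ∃ C, 0 ≤ C ∧ ∀ n : ℕ, ∀ t ∈ Icc (0:ℝ) τ,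
      ‖(M.Bop L)^[n] V t‖ ≤ C * (1 / 2) ^ n * Real.exp (l * t) := by
    intro τ
    obtain ⟨C, hC0, hC⟩ := mr_bdd V hV τ
    refine ⟨C, hC0, fun n => ?_⟩
    induction n with
    | zero =>
      intro t ht
      have := mul_le_mul_of_nonneg_left (hexp t ht.1) hC0
      simpa using (hC t ht).trans (by simpa using this)
    | succ n ih =>
      intro t ht
      rw [Function.iterate_succ_apply']
      refine (hB _ (hit n) τ _ ih t ht).trans (le_of_eq ?_)
      ring
  set W : ℝ → (X₀ →L[ℂ] X₀) := fun t => ∑' n : ℕ, (M.Bop L)^[n] V t with hWdef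
  set P : ℕ → ℝ → (X₀ →L[ℂ] X₀) := fun N t => ∑ n ∈ Finset.range N, (M.Bop L)^[n] V t
    with hPdef
  have hunif : ∀ τ : ℝ, 0 ≤ τ → TendstoUniformlyOn P W atTop (Icc 0 τ) := by
    intro τ hτ
    obtain ⟨C, hC0, hC⟩ := hbd τ
    refine tendstoUniformlyOn_tsum_nat (F := X₀ →L[ℂ] X₀)
      (f := fun n t => (M.Bop L)^[n] V t) (u := fun n => C * Real.exp (l * τ) * (1 / 2 : ℝ) ^ n)
      (summable_geometric_two.mul_left _) ?_
    intro n t ht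
    refine (hC n t ht).trans ?_
    have : Real.exp (l * t) ≤ Real.exp (l * τ) := by
      have := ht.2
      gcongr
    calc C * (1 / 2) ^ n * Real.exp (l * t) ≤ C * (1 / 2) ^ n * Real.exp (l * τ) := by gcongr
      _ = _ := by ring
  have hPc : ∀ N, ∀ x : X₀, ContinuousOn (fun t => P N t x) (Ici 0) := by
    intro N x
    have : (fun t => P N t x) = fun t => ∑ n ∈ Finset.range N, (M.Bop L)^[n] V t x := by
      funext t
      simp only [hPdef, ContinuousLinearMap.sum_apply]
    rw [this]
    exact continuousOn_finset_sum _ fun n _ => hit n x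
  have hWc : ∀ x : X₀, ContinuousOn (fun t => W t x) (Ici 0) := by
    intro x
    have hIcc : ∀ τ : ℝ, 0 ≤ τ → ContinuousOn (fun t => W t x) (Icc 0 τ) := by
      intro τ hτ
      have h1 : TendstoUniformlyOn (fun N t => P N t x) (fun t => W t x) atTop (Icc 0 τ) :=
        (ContinuousLinearMap.apply ℂ X₀ x).uniformContinuous.comp_tendstoUniformlyOn
          (hunif τ hτ)
      exact h1.continuousOn (Frequently.of_forall fun N => (hPc N x).mono Icc_subset_Ici_self)
    intro t ht
    have ht' : (0:ℝ) ≤ t := ht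
    have h1 := hIcc (t + 1) (by linarith) t ⟨ht', by linarith⟩
    refine h1.mono_of_mem_nhdsWithin ?_
    rw [← Ici_inter_Iic]
    exact inter_mem_nhdsWithin _ (Iic_mem_nhds (by linarith))
  have hPt : ∀ t : ℝ, 0 ≤ t → Tendsto (fun N => P N t) atTop (𝓝 (W t)) := fun t ht =>
    (hunif t ht).tendsto_at ⟨ht, le_rfl⟩
  have hadd : ∀ U U' : ℝ → (X₀ →L[ℂ] X₀),
      (∀ x : X₀, ContinuousOn (fun t => U t x) (Ici 0)) →
      (∀ x : X₀, ContinuousOn (fun t => U' t x) (Ici 0)) → ∀ t : ℝ, 0 ≤ t →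
      M.Bop L (fun s => U s + U' s) t = M.Bop L U t + M.Bop L U' t := by
    intro U U' hU hU' t ht
    have := mr_Bop_sub M L (fun s => U s + U' s) U'
      (fun x => (hU x).add (hU' x)) hU' t ht
    simp only [add_sub_cancel_right] at this
    rw [this, sub_add_cancel]
  have hPrec : ∀ N : ℕ, ∀ t : ℝ, 0 ≤ t → P (N + 1) t = V t + M.Bop L (P N) t := by
    intro N
    induction N with
    | zero =>
      intro t ht
      have h0 := mr_Bop_sub M L V V hV hV t ht
      simp only [sub_self] at h0
      simp [hPdef, h0]
    | succ N ih =>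
      intro t ht
      have e : P (N + 1) = fun s => P N s + (M.Bop L)^[N] V s := by
        funext s
        exact Finset.sum_range_succ _ _
      have e2 : P (N + 1 + 1) t = P (N + 1) t + (M.Bop L)^[N + 1] V t :=
        Finset.sum_range_succ _ _
      rw [e2, ih t ht, e, hadd _ _ (hPc N) (hit N) t ht, Function.iterate_succ_apply', add_assoc]
  have hWeq : ∀ t ∈ Ici (0:ℝ), W t = V t + M.Bop L W t := by
    intro t ht
    have ht' : (0:ℝ) ≤ t := ht
    have h1 : Tendsto (fun N => P (N + 1) t) atTop (𝓝 (W t)) :=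
      (tendsto_add_atTop_iff_nat 1).2 (hPt t ht')
    have h2 : Tendsto (fun N => M.Bop L (P N) t) atTop (𝓝 (M.Bop L W t)) := by
      refine (Metric.tendsto_atTop (α := X₀ →L[ℂ] X₀)).2 ?_
      intro e he
      have hE := Real.exp_pos (l * t)
      obtain ⟨N₀, hN₀⟩ := eventually_atTop.1
        ((Metric.tendstoUniformlyOn_iff (α := X₀ →L[ℂ] X₀)).1 (hunif t ht') (e / Real.exp (l * t)) (by positivity))
      refine ⟨N₀, fun N hN => ?_⟩
      rw [dist_comm, dist_eq_norm (M.Bop L W t) (M.Bop L (P N) t), ← mr_Bop_sub M L W (P N) hWc (hPc N) t ht']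
      have := hB (fun s => W s - P N s) (fun x => (hWc x).sub (hPc N x)) t
        (e / Real.exp (l * t)) (fun s hs => by
          have h3 := (hN₀ N hN s hs).le
          rw [dist_eq_norm (W s) (P N s)] at h3
          refine h3.trans ?_
          exact le_mul_of_one_le_right (by positivity) (hexp s hs.1)) t ⟨ht', le_rfl⟩
      have h4 : e / Real.exp (l * t) / 2 * Real.exp (l * t) = e / 2 := by
        field_simp
      rw [h4] at this
      linarith
    refine tendsto_nhds_unique h1 ((h2.const_add (V t)).congr fun N => ?_)
    exact (hPrec N t ht').symm
  refine ⟨W, hWc, hWeq, hunif, ?_⟩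
  intro W' hW'c hW'eq t ht
  have ht' : (0:ℝ) ≤ t := ht
  have hDc : ∀ x : X₀, ContinuousOn (fun t => (W' t - W t) x) (Ici 0) :=
    fun x => (hW'c x).sub (hWc x)
  obtain ⟨C, hC0, hC⟩ := mr_bdd (fun t => W' t - W t) hDc t
  have hD : ∀ n : ℕ, ∀ s ∈ Icc (0:ℝ) t,
      ‖W' s - W s‖ ≤ C * (1 / 2) ^ n * Real.exp (l * s) := by
    intro n
    induction n with
    | zero =>
      intro s hs
      have := mul_le_mul_of_nonneg_left (hexp s hs.1) hC0
      exact (hC s hs).trans (by simpa using this)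
    | succ n ih =>
      intro s hs
      have h1 := hB _ hDc t _ ih s hs
      rw [mr_Bop_sub M L W' W hW'c hWc s hs.1] at h1
      have h2 : W' s - W s = M.Bop L W' s - M.Bop L W s := by
        conv_lhs => rw [hW'eq s hs.1, hWeq s hs.1]
        abel
      rw [h2]
      refine h1.trans (le_of_eq ?_)
      ring
  have hlim : Tendsto (fun n : ℕ => C * (1 / 2 : ℝ) ^ n * Real.exp (l * t)) atTop (𝓝 0) := by
    have := ((tendsto_pow_atTop_nhds_zero_of_lt_one (r := (1 / 2 : ℝ)) (by norm_num)
      (by norm_num)).const_mul C).mul_const (Real.exp (l * t))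
    simpa using this
  have := ge_of_tendsto' hlim fun n => hD n t ⟨ht', le_rfl⟩
  exact sub_eq_zero.1 (norm_le_zero_iff.1 this)

end
end

section
/- Let α, β ≥ 0. (a) If t ↦ T₀(t) is norm continuous on (0,∞), then t ↦ (S ⋄ V)(t) is norm continuous on [0,∞); more generally, if L ∈ L(X₀, X) and t ↦ L ∘ T₀(t) is norm continuous on (0,∞), then t ↦ L ∘ (S ⋄ V)(t) is norm continuous on (0,∞). (b) If V is norm continuous on (0,∞), then so is S ⋄ V. (c) If T₀ is norm continuous on (α,∞) and V is norm continuous on (β,∞), then S ⋄ V is norm continuous on (α+β,∞). -/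
open Set Filter MeasureTheory
open scoped Topology

noncomputable section

variable {X : Type*} [NormedAddCommGroup X] [NormedSpace ℂ X] [CompleteSpace X]
  {X₀ : Submodule ℂ X}

section Helpers

theorem aux_bdd {E F : Type*} [NormedAddCommGroup E] [NormedSpace ℂ E] [CompleteSpace E]
    [NormedAddCommGroup F] [NormedSpace ℂ F] (A : ℝ → (E →L[ℂ] F))
    (hA : ∀ x, ContinuousOn (fun t => A t x) (Ici 0)) (K : ℝ) :
    ∃ C, 0 ≤ C ∧ ∀ s ∈ Icc (0:ℝ) K, ‖A s‖ ≤ C := by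
  have h := banach_steinhaus (g := fun s : Icc (0:ℝ) K => A s) (by
    intro x
    obtain ⟨C, hC⟩ := (isCompact_Icc (a := (0:ℝ)) (b := K)).exists_bound_of_continuousOn
      ((hA x).mono Icc_subset_Ici_self)
    exact ⟨C, fun s => hC s s.2⟩)
  obtain ⟨C, hC⟩ := h
  exact ⟨max C 0, le_max_right _ _, fun s hs => (hC ⟨s, hs⟩).trans (le_max_left _ _)⟩

theorem aux_apply {E F : Type*} [NormedAddCommGroup E] [NormedSpace ℂ E]
    [NormedAddCommGroup F] [NormedSpace ℂ F] (A : ℝ → (E →L[ℂ] F)) (f : ℝ → E) (I : Set ℝ)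
    (hA : ∀ x, ContinuousOn (fun t => A t x) I) (C : ℝ) (hC : ∀ s ∈ I, ‖A s‖ ≤ C)
    (hf : ContinuousOn f I) : ContinuousOn (fun s => A s (f s)) I := by
  intro s hs
  have h1 : Tendsto (fun t => C * ‖f t - f s‖ + ‖A t (f s) - A s (f s)‖) (𝓝[I] s) (𝓝 0) := by
    have a1 : Tendsto (fun t => f t - f s) (𝓝[I] s) (𝓝 0) :=
      tendsto_sub_nhds_zero_iff.2 (hf s hs)
    have a2 : Tendsto (fun t => A t (f s) - A s (f s)) (𝓝[I] s) (𝓝 0) :=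
      tendsto_sub_nhds_zero_iff.2 (hA (f s) s hs)
    simpa using (a1.norm.const_mul C).add a2.norm
  refine tendsto_sub_nhds_zero_iff.1 (squeeze_zero_norm' ?_ h1)
  filter_upwards [self_mem_nhdsWithin] with t ht
  have : A t (f t) - A s (f s) = A t (f t - f s) + (A t (f s) - A s (f s)) := by
    rw [map_sub]; abel
  rw [this]
  refine (norm_add_le _ _).trans (add_le_add_left ?_ _)
  exact ((A t).le_opNorm _).trans (mul_le_mul_of_nonneg_right (hC t ht) (norm_nonneg _))

theorem aux_shift {E : Type*} [NormedAddCommGroup E] [NormedSpace ℝ E] (G : ℝ → E) (D : E)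
    (a : ℝ) (ha : 0 ≤ a) (h : HasDerivWithinAt G D (Ici 0) a) :
    HasDerivWithinAt (fun e => G (a + e)) D (Ici 0) 0 := by
  have h2 : HasDerivWithinAt (fun e : ℝ => a + e) 1 (Ici 0) 0 :=
    (hasDerivWithinAt_id (0:ℝ) (Ici 0)).const_add a
  have h' : HasDerivWithinAt G D (Ici 0) ((fun e : ℝ => a + e) 0) := by simpa using h
  have := HasDerivWithinAt.scomp (0:ℝ) h' h2 (fun e (he : 0 ≤ e) => by
    show 0 ≤ a + e
    positivity)
  simpa [Function.comp_def] using this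

theorem aux_tend {E F : Type*} [NormedAddCommGroup E] [NormedSpace ℂ E]
    [NormedAddCommGroup F] [NormedSpace ℂ F] (A : ℝ → (E →L[ℂ] F)) (l : Filter ℝ)
    (a : E →L[ℂ] F) : Tendsto A l (𝓝 a) ↔ ∀ ε > 0, ∀ᶠ t in l, ‖A t - a‖ < ε := by
  have h := Metric.tendsto_nhds (u := A) (f := l) (a := a)
  simp only [dist_eq_norm] at h
  exact h

namespace MRSetting

/-- The convolution integral. -/
def conv (M : MRSetting X X₀) (f : ℝ → X) (τ : ℝ) : X₀ := ∫ s in (0:ℝ)..τ, M.S (τ - s) (f s)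

theorem complete (M : MRSetting X X₀) : CompleteSpace X₀ :=
  M.closed.completeSpace_coe

theorem integrand_cont (M : MRSetting X X₀) (f : ℝ → X) (hf : ContinuousOn f (Ici 0)) (τ : ℝ) :
    ContinuousOn (fun s => M.S (τ - s) (f s)) (Icc 0 τ) := by
  obtain ⟨C, -, hC⟩ := aux_bdd M.S M.S_cont τ
  refine aux_apply (fun s => M.S (τ - s)) f _ ?_ C ?_ (hf.mono Icc_subset_Ici_self)
  · intro x
    refine (M.S_cont x).comp (f := fun s => τ - s) (by fun_prop) ?_
    intro s hs
    simpa using hs.2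
  · intro s hs
    exact hC _ ⟨by linarith [hs.2], by linarith [hs.1]⟩

theorem integrand_int (M : MRSetting X X₀) (f : ℝ → X) (hf : ContinuousOn f (Ici 0))
    (τ a b : ℝ) (h0 : 0 ≤ a) (h : a ≤ b) (hb : b ≤ τ) :
    IntervalIntegrable (fun s => M.S (τ - s) (f s)) volume a b := by
  refine ((M.integrand_cont f hf τ).mono ?_).intervalIntegrable
  rw [uIcc_of_le h]
  exact Icc_subset_Icc h0 hb

theorem shift_cont {E : Type*} [TopologicalSpace E] (f : ℝ → E) (hf : ContinuousOn f (Ici 0))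
    (r : ℝ) (hr : 0 ≤ r) : ContinuousOn (fun s => f (r + s)) (Ici 0) :=
  hf.comp (f := fun s => r + s) (by fun_prop) (fun s (hs : 0 ≤ s) => by
    show 0 ≤ r + s
    positivity)

theorem conv_split (M : MRSetting X X₀) (f : ℝ → X) (hf : ContinuousOn f (Ici 0))
    (r h : ℝ) (hr : 0 ≤ r) (hh : 0 ≤ h) :
    M.conv f (r + h) = M.T h (M.conv f r) + M.S h (∫ s in (0:ℝ)..r, f s)
      + M.conv (fun s => f (r + s)) h := by
  have := M.complete
  have hfi : IntervalIntegrable f volume 0 r := by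
    refine (hf.mono ?_).intervalIntegrable
    rw [uIcc_of_le hr]; exact Icc_subset_Ici_self
  have hi := M.integrand_int f hf r 0 r le_rfl hr le_rfl
  have e1 := intervalIntegral.integral_add_adjacent_intervals
    (M.integrand_int f hf (r + h) 0 r le_rfl hr (by linarith))
    (M.integrand_int f hf (r + h) r (r + h) hr (by linarith) le_rfl)
  have e2 : ∫ s in (0:ℝ)..r, M.S (r + h - s) (f s)
      = M.T h (M.conv f r) + M.S h (∫ s in (0:ℝ)..r, f s) := by
    unfold conv
    rw [← ContinuousLinearMap.intervalIntegral_comp_comm _ hi,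
      ← ContinuousLinearMap.intervalIntegral_comp_comm _ hfi,
      ← intervalIntegral.integral_add]
    · refine intervalIntegral.integral_congr fun s hs => ?_
      rw [uIcc_of_le hr] at hs
      have := M.TS h (r - s) hh (by linarith [hs.2]) (f s)
      simp only [this]
      rw [show h + (r - s) = r + h - s by ring]
      abel
    · rw [intervalIntegrable_iff] at hi ⊢
      exact (M.T h).integrable_comp hi
    · rw [intervalIntegrable_iff] at hfi ⊢
      exact (M.S h).integrable_comp hfi
  have e3 : ∫ s in r..(r + h), M.S (r + h - s) (f s) = M.conv (fun s => f (r + s)) h := by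
    unfold conv
    have := intervalIntegral.integral_comp_add_left (a := 0) (b := h)
      (fun s => M.S (r + h - s) (f s)) r
    rw [add_zero] at this
    rw [← this]
    refine intervalIntegral.integral_congr fun s hs => ?_
    simp only
    rw [show r + h - (r + s) = h - s by ring]
  rw [← e2, ← e3, e1]
  rfl

theorem delta_zero (M : MRSetting X X₀) : M.δ 0 = 0 := by
  refine le_antisymm (ge_of_tendsto M.δ_lim ?_) (M.δ_nonneg 0 le_rfl)
  filter_upwards [self_mem_nhdsWithin] with t ht
  exact M.δ_mono (mem_Ici.2 le_rfl) (mem_Ici.2 (le_of_lt ht)) (le_of_lt ht)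

theorem SD_le (M : MRSetting X X₀) (f : ℝ → X) (hf : ContinuousOn f (Ici 0)) (t C : ℝ)
    (ht : 0 ≤ t) (hC0 : 0 ≤ C) (hC : ∀ s ∈ Icc (0:ℝ) t, ‖f s‖ ≤ C) : ‖M.SD f t‖ ≤ M.δ t * C :=
  (M.SD_bound f hf t ht).trans
    (mul_le_mul_of_nonneg_left (Real.iSup_le (fun s => hC s s.2) hC0) (M.δ_nonneg t ht))

theorem SD_zero (M : MRSetting X X₀) (f : ℝ → X) (hf : ContinuousOn f (Ici 0)) :
    M.SD f 0 = 0 := by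
  have := M.SD_bound f hf 0 (mem_Ici.2 le_rfl)
  rw [M.delta_zero, zero_mul] at this
  exact norm_le_zero_iff.1 this

theorem SD_split (M : MRSetting X X₀) (f : ℝ → X) (hf : ContinuousOn f (Ici 0))
    (r h : ℝ) (hr : 0 ≤ r) (hh : 0 ≤ h) :
    M.SD f (r + h) = M.T h (M.SD f r) + M.SD (fun s => f (r + s)) h := by
  have hg := shift_cont f hf r hr
  set g := fun s => f (r + s) with hgd
  have d1 := aux_shift _ _ (r + h) (by positivity) (M.SD_deriv f hf (r + h) (mem_Ici.2 (by positivity)))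
  have d2 := aux_shift _ _ r hr (M.SD_deriv f hf r hr)
  have d3 := M.SD_deriv g hg 0 (mem_Ici.2 le_rfl)
  have d4 := aux_shift _ _ h hh (M.SD_deriv g hg h hh)
  change HasDerivWithinAt (fun e => M.conv f (r + h + e)) _ _ _ at d1
  change HasDerivWithinAt (fun e => M.conv f (r + e)) _ _ _ at d2
  change HasDerivWithinAt (fun e => M.conv g e) _ _ _ at d3
  change HasDerivWithinAt (fun e => M.conv g (h + e)) _ _ _ at d4
  rw [M.SD_zero g hg] at d3
  have d5 : HasDerivWithinAt (fun e => M.T h (M.conv f (r + e) - M.conv g e))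
      (M.T h (M.SD f r - 0)) (Ici 0) 0 :=
    (((M.T h).restrictScalars ℝ).hasFDerivAt).comp_hasDerivWithinAt (0:ℝ) (d2.sub d3)
  have d6 := (d5.add d4).add_const (M.S h (∫ s in (0:ℝ)..r, f s))
  rw [sub_zero] at d6
  refine (uniqueDiffOn_Ici (0:ℝ) 0 (mem_Ici.2 le_rfl)).eq_deriv _ d1 (d6.congr_of_mem ?_ (mem_Ici.2 le_rfl))
  intro e he
  have he : 0 ≤ e := he
  have s1 := M.conv_split f hf r (h + e) hr (by positivity)
  have s2 := M.conv_split f hf r e hr he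
  have s3 := M.TS h e hh he (∫ s in (0:ℝ)..r, f s)
  have s4 := M.T_add h e hh he
  simp only [Pi.add_apply]
  rw [add_assoc r h e, s1, s2, s4]
  rw [add_sub_cancel_right, map_add, s3]
  simp only [ContinuousLinearMap.comp_apply]
  abel

theorem SD_sub (M : MRSetting X X₀) (f g : ℝ → X) (hf : ContinuousOn f (Ici 0))
    (hg : ContinuousOn g (Ici 0)) (t : ℝ) (ht : 0 ≤ t) :
    M.SD (fun s => f s - g s) t = M.SD f t - M.SD g t := by
  have d1 := M.SD_deriv _ (hf.sub hg) t ht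
  have d2 := (M.SD_deriv f hf t ht).sub (M.SD_deriv g hg t ht)
  refine (uniqueDiffOn_Ici (0:ℝ) t ht).eq_deriv _ d1 (d2.congr_of_mem ?_ ht)
  intro e he
  have he : 0 ≤ e := he
  simp only [Pi.sub_apply, map_sub]
  exact intervalIntegral.integral_sub (M.integrand_int f hf e 0 e le_rfl he le_rfl)
    (M.integrand_int g hg e 0 e le_rfl he le_rfl)

theorem SDop_le (M : MRSetting X X₀) (V : ℝ → (X₀ →L[ℂ] X))
    (hV : ∀ x : X₀, ContinuousOn (fun s => V s x) (Ici 0)) (t C : ℝ) (ht : 0 ≤ t) (hC0 : 0 ≤ C)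
    (hC : ∀ s ∈ Icc (0:ℝ) t, ‖V s‖ ≤ C) : ‖M.SDop V t‖ ≤ M.δ t * C := by
  refine ContinuousLinearMap.opNorm_le_bound _ (mul_nonneg (M.δ_nonneg t ht) hC0) fun x => ?_
  rw [M.SDop_apply V hV, mul_assoc]
  exact M.SD_le _ (hV x) t _ ht (by positivity) fun s hs =>
    ((V s).le_opNorm x).trans (mul_le_mul_of_nonneg_right (hC s hs) (norm_nonneg _))

theorem SDop_split (M : MRSetting X X₀) (V : ℝ → (X₀ →L[ℂ] X))
    (hV : ∀ x : X₀, ContinuousOn (fun s => V s x) (Ici 0)) (r h : ℝ) (hr : 0 ≤ r) (hh : 0 ≤ h) :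
    M.SDop V (r + h) = (M.T h).comp (M.SDop V r) + M.SDop (fun s => V (r + s)) h := by
  ext1 x
  simp only [add_apply, ContinuousLinearMap.comp_apply]
  rw [M.SDop_apply V hV, M.SDop_apply V hV, M.SDop_apply _ (fun x => shift_cont _ (hV x) r hr)]
  exact M.SD_split _ (hV x) r h hr hh

theorem SDop_sub (M : MRSetting X X₀) (V W : ℝ → (X₀ →L[ℂ] X))
    (hV : ∀ x : X₀, ContinuousOn (fun s => V s x) (Ici 0))
    (hW : ∀ x : X₀, ContinuousOn (fun s => W s x) (Ici 0)) (t : ℝ) (ht : 0 ≤ t) :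
    M.SDop (fun s => V s - W s) t = M.SDop V t - M.SDop W t := by
  ext1 x
  rw [sub_apply, M.SDop_apply V hV, M.SDop_apply W hW, M.SDop_apply _
    (fun x => (hV x).sub (hW x))]
  exact M.SD_sub _ _ (hV x) (hW x) t ht

theorem delta_small (M : MRSetting X X₀) (C ε : ℝ) (hε : 0 < ε) :
    ∃ η > 0, ∀ t, 0 ≤ t → t ≤ η → M.δ t * C < ε := by
  have h : Tendsto (fun t => M.δ t * |C|) (𝓝[>] 0) (𝓝 0) := by
    simpa using M.δ_lim.mul_const |C|
  obtain ⟨η, h1, h2⟩ := ((h.eventually (gt_mem_nhds hε)).and self_mem_nhdsWithin).exists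
  have h2 : 0 < η := h2
  refine ⟨η, h2, fun t ht hte => lt_of_le_of_lt ?_ h1⟩
  calc M.δ t * C ≤ M.δ t * |C| := mul_le_mul_of_nonneg_left (le_abs_self C) (M.δ_nonneg t ht)
    _ ≤ _ := mul_le_mul_of_nonneg_right
      (M.δ_mono (mem_Ici.2 ht) (mem_Ici.2 h2.le) hte) (abs_nonneg _)

/-- `V` norm continuous on `[0,∞)` implies `S ⋄ V` norm continuous on `[0,∞)`. -/
theorem cont_of_cont (M : MRSetting X X₀) (V : ℝ → (X₀ →L[ℂ] X)) (hVc : ContinuousOn V (Ici 0)) :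
    ContinuousOn (M.SDop V) (Ici 0) := by
  have := M.complete
  have hV : ∀ x : X₀, ContinuousOn (fun s => V s x) (Ici 0) := fun x =>
    hVc.clm_apply continuousOn_const
  intro t₀ ht₀
  have ht₀ : 0 ≤ t₀ := ht₀
  set K := t₀ + 1 with hK
  obtain ⟨CV, hCV0, hCV⟩ := aux_bdd V hV K
  obtain ⟨CT, hCT0, hCT⟩ := aux_bdd M.T M.T_cont K
  refine (aux_tend _ _ _).2 ?_
  intro ε hε
  have huc := (isCompact_Icc (a := (0:ℝ)) (b := K)).uniformContinuousOn_of_continuous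
    (hVc.mono Icc_subset_Ici_self)
  have hδK := M.δ_nonneg K (by linarith)
  obtain ⟨η₁, hη₁, hu⟩ := (Metric.uniformContinuousOn_iff_le (f := V) (s := Icc (0:ℝ) K)).1 huc
    (ε / 2 / (M.δ K + 1)) (by positivity)
  obtain ⟨η₂, hη₂, hd⟩ := M.delta_small (CT * CV) (ε / 2) (by positivity)
  have key : ∀ t h, 0 ≤ t → 0 ≤ h → t + h ≤ K → h ≤ η₁ → h ≤ η₂ →
      ‖M.SDop V (t + h) - M.SDop V t‖ < ε := by
    intro t h ht hh htK h1 h2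
    have hVs : ∀ x : X₀, ContinuousOn (fun s => V (h + s) x) (Ici 0) :=
      fun x => shift_cont (fun s => V s x) (hV x) h hh
    have e := M.SDop_split V hV h t hh ht
    have e2 := M.SDop_sub (fun s => V (h + s)) V hVs hV t ht
    have e3 : M.SDop V (t + h) - M.SDop V t = (M.T t).comp (M.SDop V h)
        + M.SDop (fun s => V (h + s) - V s) t := by
      rw [add_comm t h, e, e2]; abel
    rw [e3]
    have b1 : ‖(M.T t).comp (M.SDop V h)‖ < ε / 2 := by
      refine lt_of_le_of_lt (ContinuousLinearMap.opNorm_comp_le _ _) (lt_of_le_of_lt ?_ (hd h hh h2))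
      have := M.SDop_le V hV h CV hh hCV0 (fun s hs => hCV s ⟨hs.1, by linarith [hs.2]⟩)
      calc _ ≤ CT * (M.δ h * CV) := mul_le_mul (hCT t ⟨ht, by linarith⟩) this (ContinuousLinearMap.opNorm_nonneg _) hCT0
        _ = _ := by ring
    have b2 : ‖M.SDop (fun s => V (h + s) - V s) t‖ ≤ ε / 2 := by
      have := M.SDop_le (fun s => V (h + s) - V s) (fun x => (hVs x).sub (hV x)) t
        (ε / 2 / (M.δ K + 1)) ht (by positivity) (fun s hs => by
          refine (dist_eq_norm (V (h + s)) (V s)).symm.le.trans ?_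
          refine hu _ ⟨by linarith [hs.1], by linarith [hs.2]⟩ _ ⟨hs.1, by linarith [hs.2]⟩ ?_
          rw [Real.dist_eq, add_sub_cancel_right, abs_of_nonneg hh]
          exact h1)
      refine this.trans ?_
      have hm : M.δ t ≤ M.δ K + 1 :=
        (M.δ_mono (mem_Ici.2 ht) (mem_Ici.2 (show 0 ≤ K by linarith))
          (show t ≤ K by linarith)).trans (by linarith)
      calc _ ≤ (M.δ K + 1) * (ε / 2 / (M.δ K + 1)) :=
            mul_le_mul_of_nonneg_right hm (by positivity)
        _ = ε / 2 := by field_simp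
    have n := norm_add_le ((M.T t).comp (M.SDop V h)) (M.SDop (fun s => V (h + s) - V s) t)
    exact lt_of_le_of_lt n (by linarith)
  have hmin : 0 < min 1 (min η₁ η₂) := by positivity
  filter_upwards [self_mem_nhdsWithin,
    mem_nhdsWithin_of_mem_nhds (Metric.ball_mem_nhds t₀ hmin)] with t ht hdist
  have ht : 0 ≤ t := ht
  rw [Metric.mem_ball, Real.dist_eq, lt_min_iff, lt_min_iff] at hdist
  obtain ⟨a1, a2, a3⟩ := hdist
  rcases le_total t₀ t with hle | hle
  · rw [abs_of_nonneg (by linarith)] at a1 a2 a3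
    have := key t₀ (t - t₀) ht₀ (by linarith) (by linarith) a2.le a3.le
    rwa [add_sub_cancel] at this
  · rw [abs_of_nonpos (by linarith)] at a1 a2 a3
    have := key t (t₀ - t) ht (by linarith) (by linarith) (by linarith) (by linarith)
    rw [add_sub_cancel] at this
    rwa [norm_sub_rev]

theorem shift_cont_op (V : ℝ → (X₀ →L[ℂ] X)) (b r : ℝ) (hr : b < r)
    (hVc : ContinuousOn V (Ioi b)) : ContinuousOn (fun s => V (r + s)) (Ici 0) :=
  hVc.comp (f := fun s => r + s) (by fun_prop) (fun s (hs : 0 ≤ s) => by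
    show b < r + s
    linarith)

/-- the shifted diamond term is norm continuous at points beyond the shift. -/
theorem shifted_contAt (M : MRSetting X X₀) (V : ℝ → (X₀ →L[ℂ] X)) (b r t₀ : ℝ) (hr : b < r)
    (hVc : ContinuousOn V (Ioi b)) (ht : r < t₀) :
    ContinuousAt (fun t => M.SDop (fun s => V (r + s)) (t - r)) t₀ := by
  have h := (M.cont_of_cont _ (shift_cont_op V b r hr hVc)).continuousAt
    (Ici_mem_nhds (show (0:ℝ) < t₀ - r by linarith))
  exact ContinuousAt.comp (f := fun t => t - r) h (by fun_prop)

theorem part_a (M : MRSetting X X₀) (V : ℝ → (X₀ →L[ℂ] X))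
    (hV : ∀ x : X₀, ContinuousOn (fun s => V s x) (Ici 0))
    {Y : Type*} [NormedAddCommGroup Y] [NormedSpace ℂ Y] (L : X₀ →L[ℂ] Y)
    (hL : ContinuousOn (fun t => L.comp (M.T t)) (Ioi 0)) :
    ContinuousOn (fun t => L.comp (M.SDop V t)) (Ioi 0) := by
  have := M.complete
  intro t₀ ht₀
  have ht₀ : 0 < t₀ := ht₀
  refine ContinuousAt.continuousWithinAt ?_
  obtain ⟨C, hC0, hC⟩ := aux_bdd V hV (t₀ + 1)
  refine (aux_tend _ _ _).2 ?_
  intro ε hε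
  obtain ⟨η, hη, hd⟩ := M.delta_small (‖L‖ * C) (ε / 3) (by positivity)
  obtain ⟨r, hr1, hr2⟩ : ∃ r, max 0 (t₀ - η) < r ∧ r < t₀ :=
    exists_between (max_lt ht₀ (by linarith))
  obtain ⟨hr0, hrη⟩ := max_lt_iff.1 hr1
  have hc : ContinuousAt (fun t => (L.comp (M.T (t - r))).comp (M.SDop V r)) t₀ := by
    have h1 : ContinuousAt (fun t => L.comp (M.T (t - r))) t₀ :=
      ContinuousAt.comp (f := fun t => t - r) (g := fun t => L.comp (M.T t))
        (hL.continuousAt (Ioi_mem_nhds (show (0:ℝ) < t₀ - r by linarith))) (by fun_prop)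
    exact h1.clm_comp continuousAt_const
  replace hc := (aux_tend _ _ _).1 hc
  have dec : ∀ t, r ≤ t → L.comp (M.SDop V t) = (L.comp (M.T (t - r))).comp (M.SDop V r)
      + L.comp (M.SDop (fun s => V (r + s)) (t - r)) := by
    intro t ht
    have := M.SDop_split V hV r (t - r) hr0.le (by linarith)
    rw [add_sub_cancel] at this
    rw [this, ContinuousLinearMap.comp_add, ContinuousLinearMap.comp_assoc]
  have bd : ∀ t, r ≤ t → t ≤ t₀ + 1 → t ≤ r + η →
      ‖L.comp (M.SDop (fun s => V (r + s)) (t - r))‖ < ε / 3 := by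
    intro t h1 h2 h3
    refine lt_of_le_of_lt (ContinuousLinearMap.opNorm_comp_le _ _)
      (lt_of_le_of_lt ?_ (hd (t - r) (by linarith) (by linarith)))
    have := M.SDop_le (fun s => V (r + s)) (fun x => shift_cont (fun s => V s x) (hV x) r hr0.le)
      (t - r) C (by linarith) hC0 (fun s hs => hC _ ⟨by linarith [hs.1], by linarith [hs.2]⟩)
    calc _ ≤ ‖L‖ * (M.δ (t - r) * C) := mul_le_mul_of_nonneg_left this (ContinuousLinearMap.opNorm_nonneg _)
      _ = _ := by ring
  filter_upwards [hc (ε / 3) (by positivity), Ioi_mem_nhds hr2,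
    Iio_mem_nhds (show t₀ < t₀ + 1 by linarith), Iio_mem_nhds (show t₀ < r + η by linarith)]
    with t h1 h2 h3 h4
  have h2 : r < t := h2
  have h3 : t < t₀ + 1 := h3
  have h4 : t < r + η := h4
  have b1 := bd t h2.le h3.le h4.le
  have b2 := bd t₀ hr2.le (by linarith) (by linarith)
  rw [dec t h2.le, dec t₀ hr2.le, add_sub_add_comm]
  have n1 := norm_add_le ((L.comp (M.T (t - r))).comp (M.SDop V r)
    - (L.comp (M.T (t₀ - r))).comp (M.SDop V r))
    (L.comp (M.SDop (fun s => V (r + s)) (t - r))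
      - L.comp (M.SDop (fun s => V (r + s)) (t₀ - r)))
  have n2 := norm_sub_le (L.comp (M.SDop (fun s => V (r + s)) (t - r)))
    (L.comp (M.SDop (fun s => V (r + s)) (t₀ - r)))
  linarith

theorem cont_zero (M : MRSetting X X₀) (V : ℝ → (X₀ →L[ℂ] X))
    (hV : ∀ x : X₀, ContinuousOn (fun s => V s x) (Ici 0)) :
    ContinuousWithinAt (M.SDop V) (Ici 0) 0 := by
  have := M.complete
  obtain ⟨C, hC0, hC⟩ := aux_bdd V hV 1
  have hz : M.SDop V 0 = 0 := by
    ext1 x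
    rw [M.SDop_apply V hV, M.SD_zero _ (hV x)]; rfl
  refine (aux_tend _ _ _).2 ?_
  intro ε hε
  rw [hz]
  simp only [sub_zero]
  obtain ⟨η, hη, hd⟩ := M.delta_small C ε hε
  filter_upwards [self_mem_nhdsWithin, mem_nhdsWithin_of_mem_nhds (Iio_mem_nhds hη),
    mem_nhdsWithin_of_mem_nhds (Iio_mem_nhds (show (0:ℝ) < 1 by norm_num))] with t h1 h2 h3
  have h1 : 0 ≤ t := h1
  have h2 : t < η := h2
  have h3 : t < 1 := h3
  exact (M.SDop_le V hV t C h1 hC0 (fun s hs => hC s ⟨hs.1, by linarith [hs.2]⟩)).trans_lt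
    (hd t h1 h2.le)

theorem part_b (M : MRSetting X X₀) (V : ℝ → (X₀ →L[ℂ] X))
    (hV : ∀ x : X₀, ContinuousOn (fun s => V s x) (Ici 0)) (hVc : ContinuousOn V (Ioi 0)) :
    ContinuousOn (M.SDop V) (Ioi 0) := by
  have := M.complete
  intro t₀ ht₀
  have ht₀ : 0 < t₀ := ht₀
  refine ContinuousAt.continuousWithinAt ?_
  obtain ⟨C, hC0, hC⟩ := aux_bdd V hV (t₀ + 1)
  obtain ⟨CT, hCT0, hCT⟩ := aux_bdd M.T M.T_cont (t₀ + 1)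
  refine (aux_tend _ _ _).2 ?_
  intro ε hε
  obtain ⟨η, hη, hd⟩ := M.delta_small (CT * C) (ε / 3) (by positivity)
  obtain ⟨r, hr0, hr⟩ : ∃ r, 0 < r ∧ r < min t₀ η := exists_between (lt_min ht₀ hη)
  obtain ⟨hr2, hrη⟩ := lt_min_iff.1 hr
  have hc := M.shifted_contAt V 0 r t₀ hr0 hVc hr2
  replace hc := (aux_tend _ _ _).1 hc
  have dec : ∀ t, r ≤ t → M.SDop V t = (M.T (t - r)).comp (M.SDop V r)
      + M.SDop (fun s => V (r + s)) (t - r) := by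
    intro t ht
    have := M.SDop_split V hV r (t - r) hr0.le (by linarith)
    rwa [add_sub_cancel] at this
  have bd : ∀ t, r ≤ t → t ≤ t₀ + 1 → ‖(M.T (t - r)).comp (M.SDop V r)‖ < ε / 3 := by
    intro t h1 h2
    refine lt_of_le_of_lt (ContinuousLinearMap.opNorm_comp_le _ _)
      (lt_of_le_of_lt ?_ (hd r hr0.le hrη.le))
    have := M.SDop_le V hV r C hr0.le hC0 (fun s hs => hC _ ⟨hs.1, by linarith [hs.2]⟩)
    calc _ ≤ CT * (M.δ r * C) :=
          mul_le_mul (hCT _ ⟨by linarith, by linarith⟩) this (ContinuousLinearMap.opNorm_nonneg _) hCT0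
      _ = _ := by ring
  filter_upwards [hc (ε / 3) (by positivity), Ioi_mem_nhds hr2,
    Iio_mem_nhds (show t₀ < t₀ + 1 by linarith)] with t h1 h2 h3
  have h2 : r < t := h2
  have h3 : t < t₀ + 1 := h3
  have b1 := bd t h2.le h3.le
  have b2 := bd t₀ hr2.le (by linarith)
  rw [dec t h2.le, dec t₀ hr2.le, add_sub_add_comm]
  have n1 := norm_add_le ((M.T (t - r)).comp (M.SDop V r) - (M.T (t₀ - r)).comp (M.SDop V r))
    (M.SDop (fun s => V (r + s)) (t - r) - M.SDop (fun s => V (r + s)) (t₀ - r))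
  have n2 := norm_sub_le ((M.T (t - r)).comp (M.SDop V r)) ((M.T (t₀ - r)).comp (M.SDop V r))
  linarith

theorem part_c (M : MRSetting X X₀) (V : ℝ → (X₀ →L[ℂ] X))
    (hV : ∀ x : X₀, ContinuousOn (fun s => V s x) (Ici 0)) (α β : ℝ) (hα : 0 ≤ α) (hβ : 0 ≤ β)
    (hT : ContinuousOn M.T (Ioi α)) (hVc : ContinuousOn V (Ioi β)) :
    ContinuousOn (M.SDop V) (Ioi (α + β)) := by
  intro t₀ ht₀
  have ht₀ : α + β < t₀ := ht₀
  refine ContinuousAt.continuousWithinAt ?_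
  obtain ⟨r, hr1, hr2⟩ : ∃ r, β < r ∧ r < t₀ - α := exists_between (by linarith)
  have h1 : ContinuousAt (fun t => M.T (t - r)) t₀ :=
    ContinuousAt.comp (f := fun t => t - r) (g := M.T)
      (hT.continuousAt (Ioi_mem_nhds (show α < t₀ - r by linarith))) (by fun_prop)
  have hc := (h1.clm_comp (continuousAt_const (y := M.SDop V r))).add
    (M.shifted_contAt V β r t₀ hr1 hVc (by linarith))
  refine hc.congr ?_
  filter_upwards [Ioi_mem_nhds (show r < t₀ by linarith)] with t ht
  have ht : r < t := ht
  have := M.SDop_split V hV r (t - r) (by linarith) (by linarith)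
  rw [add_sub_cancel] at this
  exact this.symm

end MRSetting

end Helpers

/-- norm continuity of `S ⋄ V`. -/
theorem diamond_norm_continuity (M : MRSetting X X₀)
    (V : ℝ → (X₀ →L[ℂ] X)) (hV : ∀ x : X₀, ContinuousOn (fun s => V s x) (Ici 0))
    (α β : ℝ) (hα : 0 ≤ α) (hβ : 0 ≤ β) :
    ((ContinuousOn M.T (Ioi 0) → ContinuousOn (M.SDop V) (Ici 0)) ∧
     (∀ L : X₀ →L[ℂ] X, ContinuousOn (fun t => L.comp (M.T t)) (Ioi 0) →
        ContinuousOn (fun t => L.comp (M.SDop V t)) (Ioi 0))) ∧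
    (ContinuousOn V (Ioi 0) → ContinuousOn (M.SDop V) (Ioi 0)) ∧
    (ContinuousOn M.T (Ioi α) → ContinuousOn V (Ioi β) →
      ContinuousOn (M.SDop V) (Ioi (α + β))) := by
  refine ⟨⟨fun hT => ?_, fun L hL => M.part_a V hV L hL⟩, M.part_b V hV,
    M.part_c V hV α β hα hβ⟩
  intro t ht
  rcases eq_or_lt_of_le (show 0 ≤ t from ht) with h0 | h0
  · rw [← h0]
    exact M.cont_zero V hV
  · have h := M.part_a V hV (ContinuousLinearMap.id ℂ X₀)
      (by simpa only [ContinuousLinearMap.id_comp] using hT)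
    simp only [ContinuousLinearMap.id_comp] at h
    exact (h.continuousAt (Ioi_mem_nhds h0)).continuousWithinAt

end
end
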